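/- For every g ∈ G, the sections g₀ and g₁ of g belong to G and satisfy ℓ(g₀) + ℓ(g₁) ≤ ℓ(g) + 1. -/

import Mathlib

namespace Grig

def aFun : List Bool → List Bool
  | [] => []
  | x :: v => (!x) :: v

mutual
  def bFun : List Bool → List Bool
    | [] => []
    | false :: v => false :: aFun v
    | true :: v => true :: cFun v
  def cFun : List Bool → List Bool
    | [] => []
    | false :: v => false :: aFun v
    | true :: v => true :: dFun v
  def dFun : List Bool → List Bool
    | [] => []
    | false :: v => false :: v
    | true :: v => true :: bFun v
end

theorem aFun_invol : Function.Involutive aFun := by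
  intro v; cases v <;> simp [aFun]

theorem bcd_invol : ∀ v, bFun (bFun v) = v ∧ cFun (cFun v) = v ∧ dFun (dFun v) = v := by
  intro v
  induction v with
  | nil => simp [bFun, cFun, dFun]
  | cons x v ih =>
    cases x <;> simp [bFun, cFun, dFun, aFun_invol v, ih.1, ih.2.1, ih.2.2]

/-- The automorphism `a` of the binary tree. -/
def a : Equiv.Perm (List Bool) := Function.Involutive.toPerm aFun aFun_invol

def b : Equiv.Perm (List Bool) := Function.Involutive.toPerm bFun (fun v => (bcd_invol v).1)

def c : Equiv.Perm (List Bool) := Function.Involutive.toPerm cFun (fun v => (bcd_invol v).2.1)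

def d : Equiv.Perm (List Bool) := Function.Involutive.toPerm dFun (fun v => (bcd_invol v).2.2)

/-- The Grigorchuk group, as the subgroup generated by `a, b, c, d` inside the
permutation group of the vertex set of the binary tree. -/
def grigG : Subgroup (Equiv.Perm (List Bool)) := Subgroup.closure {a, b, c, d}

end Grig

namespace Grig

/-- The word length of `g`: the least `n` such that `g` is a product of `n` elements of
`{a, b, c, d}`. -/
noncomputable def wlen (g : Equiv.Perm (List Bool)) : ℕ :=
  sInf {n : ℕ | ∃ l : List (Equiv.Perm (List Bool)), l.length = n ∧
    (∀ x ∈ l, x ∈ ({a, b, c, d} : Set (Equiv.Perm (List Bool)))) ∧ l.prod = g}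

end Grig

namespace Grig

/-- The generating set without `a`. -/
def IsX (x : Equiv.Perm (List Bool)) : Prop := x = b ∨ x = c ∨ x = d

/-- `W n g`: `g` is a product of `n` generators. -/
inductive W : ℕ → Equiv.Perm (List Bool) → Prop
  | one : W 0 1
  | ca {n g} : W n g → W (n + 1) (a * g)
  | cx {n g x} : IsX x → W n g → W (n + 1) (x * g)

/-- Alternating words; the flag `true` means that it starts with one of `b, c, d`. -/
inductive Red : Bool → ℕ → Equiv.Perm (List Bool) → Prop
  | one (t) : Red t 0 1
  | ca {n g} : Red true n g → Red false (n + 1) (a * g)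
  | cx {n g x} : IsX x → Red false n g → Red true (n + 1) (x * g)

theorem aa : a * a = 1 := by
  ext1 v; exact aFun_invol v

theorem bcd_mul : ∀ v, (bFun (cFun v) = dFun v ∧ cFun (bFun v) = dFun v) ∧
    (bFun (dFun v) = cFun v ∧ dFun (bFun v) = cFun v) ∧
    (cFun (dFun v) = bFun v ∧ dFun (cFun v) = bFun v) := by
  intro v
  induction v with
  | nil => simp [bFun, cFun, dFun]
  | cons x v ih =>
    cases x <;> simp [bFun, cFun, dFun, aFun_invol v, ih]

theorem xx {x y : Equiv.Perm (List Bool)} (hx : IsX x) (hy : IsX y) :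
    x * y = 1 ∨ IsX (x * y) := by
  have e1 : b * c = d := by ext1 v; exact (bcd_mul v).1.1
  have e2 : c * b = d := by ext1 v; exact (bcd_mul v).1.2
  have e3 : b * d = c := by ext1 v; exact (bcd_mul v).2.1.1
  have e4 : d * b = c := by ext1 v; exact (bcd_mul v).2.1.2
  have e5 : c * d = b := by ext1 v; exact (bcd_mul v).2.2.1
  have e6 : d * c = b := by ext1 v; exact (bcd_mul v).2.2.2
  have e7 : b * b = 1 := by ext1 v; exact (bcd_invol v).1
  have e8 : c * c = 1 := by ext1 v; exact (bcd_invol v).2.1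
  have e9 : d * d = 1 := by ext1 v; exact (bcd_invol v).2.2
  rcases hx with rfl | rfl | rfl <;> rcases hy with rfl | rfl | rfl <;>
    simp only [e1, e2, e3, e4, e5, e6, e7, e8, e9] <;> simp [IsX]

theorem W.red {n g} (h : W n g) : ∃ t m, m ≤ n ∧ Red t m g := by
  induction h with
  | one => exact ⟨true, 0, le_rfl, .one _⟩
  | ca _ ih =>
    obtain ⟨t, m, hm, h⟩ := ih
    cases h with
    | one => exact ⟨false, 1, by omega, .ca (.one _)⟩
    | ca h => rw [← mul_assoc, aa, one_mul]; exact ⟨true, _, by omega, h⟩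
    | cx hx h => exact ⟨false, _, by omega, .ca (.cx hx h)⟩
  | cx hx _ ih =>
    obtain ⟨t, m, hm, h⟩ := ih
    cases h with
    | one => exact ⟨true, 1, by omega, .cx hx (.one _)⟩
    | ca h => exact ⟨true, _, by omega, .cx hx (.ca h)⟩
    | cx hy h =>
      rw [← mul_assoc]
      rcases xx hx hy with e | e
      · rw [e, one_mul]; exact ⟨false, _, by omega, h⟩
      · exact ⟨true, _, hm.trans (by omega), .cx e h⟩

theorem x_false {x} (hx : IsX x) : ∃ u, (u = a ∨ u = 1) ∧
    ∀ w, x (false :: w) = false :: u w := by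
  rcases hx with rfl | rfl | rfl
  · exact ⟨a, .inl rfl, fun w => by change bFun _ = _; rw [bFun]; rfl⟩
  · exact ⟨a, .inl rfl, fun w => by change cFun _ = _; rw [cFun]; rfl⟩
  · exact ⟨1, .inr rfl, fun w => by change dFun _ = _; rw [dFun]; rfl⟩

theorem x_true {x} (hx : IsX x) : ∃ u, IsX u ∧
    ∀ w, x (true :: w) = true :: u w := by
  rcases hx with rfl | rfl | rfl
  · exact ⟨c, by simp [IsX], fun w => by change bFun _ = _; rw [bFun]; rfl⟩
  · exact ⟨d, by simp [IsX], fun w => by change cFun _ = _; rw [cFun]; rfl⟩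
  · exact ⟨b, by simp [IsX], fun w => by change dFun _ = _; rw [dFun]; rfl⟩

theorem a_cons (x : Bool) (w) : a (x :: w) = (!x) :: w := rfl

theorem Red.sec {t m g} (h : Red t m g) : ∃ (s : Bool) (g0 g1 : Equiv.Perm (List Bool))
    (n0 n1 : ℕ), W n0 g0 ∧ W n1 g1 ∧ n0 + n1 ≤ m + t.toNat ∧
    (∀ w, g (false :: w) = s :: g0 w) ∧ (∀ w, g (true :: w) = (!s) :: g1 w) := by
  induction h with
  | one t => exact ⟨false, 1, 1, 0, 0, .one, .one, by simp, fun _ => rfl, fun _ => rfl⟩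
  | ca _ ih =>
    obtain ⟨s, g0, g1, n0, n1, h0, h1, hn, e0, e1⟩ := ih
    refine ⟨!s, g0, g1, n0, n1, h0, h1, by simpa using hn, fun w => ?_, fun w => ?_⟩
    · rw [Equiv.Perm.mul_apply, e0, a_cons]
    · rw [Equiv.Perm.mul_apply, e1, a_cons]
  | cx hx _ ih =>
    obtain ⟨s, g0, g1, n0, n1, h0, h1, hn, e0, e1⟩ := ih
    obtain ⟨u, hu, eu⟩ := x_false hx
    obtain ⟨v, hv, ev⟩ := x_true hx
    have key : ∀ n k, W n k → ∃ n', n' ≤ n + 1 ∧ W n' (u * k) := by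
      intro n k hk
      rcases hu with rfl | rfl
      · exact ⟨_, le_rfl, .ca hk⟩
      · exact ⟨n, by omega, by rwa [one_mul]⟩
    simp only [Bool.toNat_false, Bool.toNat_true] at hn ⊢
    cases s
    · obtain ⟨n', hn', hk⟩ := key _ _ h0
      refine ⟨false, u * g0, v * g1, n', n1 + 1, hk, .cx hv h1, by omega, fun w => ?_, fun w => ?_⟩
      · rw [Equiv.Perm.mul_apply, e0, eu]; rfl
      · rw [Equiv.Perm.mul_apply, e1, Bool.not_false, ev]; rfl
    · obtain ⟨n', hn', hk⟩ := key _ _ h1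
      refine ⟨true, v * g0, u * g1, n0 + 1, n', .cx hv h0, hk, by omega, fun w => ?_, fun w => ?_⟩
      · rw [Equiv.Perm.mul_apply, e0, ev]; rfl
      · rw [Equiv.Perm.mul_apply, e1, Bool.not_true, eu]; rfl

theorem W.list {n g} (h : W n g) : ∃ l : List (Equiv.Perm (List Bool)), l.length = n ∧
    (∀ x ∈ l, x ∈ ({a, b, c, d} : Set (Equiv.Perm (List Bool)))) ∧ l.prod = g := by
  induction h with
  | one => exact ⟨[], rfl, by simp, rfl⟩
  | ca _ ih =>
    obtain ⟨l, h1, h2, h3⟩ := ih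
    refine ⟨a :: l, by simp [h1], ?_, by simp [h3]⟩
    intro y hy
    rcases List.mem_cons.1 hy with rfl | hy
    · simp
    · exact h2 _ hy
  | @cx _ _ x hx _ ih =>
    obtain ⟨l, h1, h2, h3⟩ := ih
    refine ⟨x :: l, by simp [h1], ?_, by simp [h3]⟩
    intro y hy
    rcases List.mem_cons.1 hy with rfl | hy
    · exact .inr hx
    · exact h2 _ hy

theorem W.of_list (l : List (Equiv.Perm (List Bool)))
    (h : ∀ x ∈ l, x ∈ ({a, b, c, d} : Set (Equiv.Perm (List Bool)))) : W l.length l.prod := by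
  induction l with
  | nil => exact .one
  | cons x l ih =>
    have ih := ih fun y hy => h y (List.mem_cons_of_mem _ hy)
    rw [List.prod_cons, List.length_cons]
    rcases h x List.mem_cons_self with rfl | hx
    · exact .ca ih
    · exact .cx hx ih

theorem W.wlen_le {n g} (h : W n g) : wlen g ≤ n := Nat.sInf_le h.list

theorem W.mem {n g} (h : W n g) : g ∈ grigG := by
  obtain ⟨l, -, h2, rfl⟩ := h.list
  exact Subgroup.list_prod_mem _ fun x hx => Subgroup.subset_closure (h2 x hx)

theorem W_wlen {g} (hg : g ∈ grigG) : W (wlen g) g := by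
  have hg' : g ∈ (Subgroup.closure ({a, b, c, d} : Set (Equiv.Perm (List Bool)))).toSubmonoid := hg
  rw [Subgroup.closure_toSubmonoid] at hg'
  obtain ⟨l, hl, rfl⟩ := Submonoid.exists_list_of_mem_closure hg'
  have hl' : ∀ x ∈ l, x ∈ ({a, b, c, d} : Set (Equiv.Perm (List Bool))) := by
    intro x hx
    rcases hl x hx with h | h
    · exact h
    · replace h : x⁻¹ ∈ ({a, b, c, d} : Set (Equiv.Perm (List Bool))) := h
      have : x⁻¹⁻¹ = x⁻¹ := by
        rcases h with h | h | h | h <;> rw [h] <;> rfl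
      rw [← inv_inv x, this]; exact h
  obtain ⟨l', h1, h2, h3⟩ := Nat.sInf_mem (s := {n : ℕ | ∃ l' : List (Equiv.Perm (List Bool)),
    l'.length = n ∧ (∀ x ∈ l', x ∈ ({a, b, c, d} : Set (Equiv.Perm (List Bool)))) ∧
      l'.prod = l.prod}) ⟨_, l, rfl, hl', rfl⟩
  have := W.of_list l' h2
  rw [h1, h3] at this
  exact this

/-- For every `g ∈ G`, the sections `g₀, g₁` (characterized by
`g (x :: w) = σ x :: g_x w`, where `σ` is the induced permutation of the first level)
belong to `G` and satisfy `ℓ(g₀) + ℓ(g₁) ≤ ℓ(g) + 1`. -/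
theorem section_length_sum (g g₀ g₁ : Equiv.Perm (List Bool)) (hg : g ∈ grigG)
    (σ : Equiv.Perm Bool)
    (h0 : ∀ w : List Bool, g (false :: w) = σ false :: g₀ w)
    (h1 : ∀ w : List Bool, g (true :: w) = σ true :: g₁ w) :
    g₀ ∈ grigG ∧ g₁ ∈ grigG ∧ wlen g₀ + wlen g₁ ≤ wlen g + 1 := by
  obtain ⟨t, m, hm, hr⟩ := (W_wlen hg).red
  obtain ⟨s, k0, k1, n0, n1, w0, w1, hn, e0, e1⟩ := hr.sec
  have q0 : g₀ = k0 := by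
    ext1 w; exact (List.cons.inj ((h0 w).symm.trans (e0 w))).2
  have q1 : g₁ = k1 := by
    ext1 w; exact (List.cons.inj ((h1 w).symm.trans (e1 w))).2
  subst q0 q1
  have := w0.wlen_le
  have := w1.wlen_le
  have := Bool.toNat_le t
  exact ⟨w0.mem, w1.mem, by omega⟩

end Grig
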